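/- Every near-triangulation G on exactly 6 vertices has a vertex x such that the closed neighborhood N[x] contains all internal vertices of G. -/

import Mathlib

open Set

/-- A plane graph: a finite simple graph whose vertices are points of the plane,
together with a plane embedding in which every edge is drawn as an arc (the range of an
injective path) joining its endpoints, two arcs meet only in common endpoints, and
no vertex lies on an arc other than at its endpoints. -/
structure PlaneGraph where
  verts : Set (ℝ × ℝ)
  finite_verts : verts.Finite
  Adj : (ℝ × ℝ) → (ℝ × ℝ) → Prop
  adj_symm : ∀ u v, Adj u v → Adj v u
  adj_irrefl : ∀ v, ¬ Adj v v
  adj_mem : ∀ u v, Adj u v → u ∈ verts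
  arc : (ℝ × ℝ) → (ℝ × ℝ) → Set (ℝ × ℝ)
  arc_symm : ∀ u v, arc u v = arc v u
  arc_path : ∀ u v, Adj u v → ∃ γ : Path u v, Function.Injective ⇑γ ∧ arc u v = Set.range ⇑γ
  arc_verts : ∀ u v, Adj u v → verts ∩ arc u v ⊆ {u, v}
  arc_inter : ∀ u v u' v', Adj u v → Adj u' v' → ({u, v} : Set (ℝ × ℝ)) ≠ {u', v'} →
    arc u v ∩ arc u' v' ⊆ ({u, v} : Set (ℝ × ℝ)) ∩ {u', v'}

namespace PlaneGraph

/-- The plane subgraph induced on a set of vertices, with the inherited embedding. -/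
def induce (G : PlaneGraph) (S : Set (ℝ × ℝ)) : PlaneGraph where
  verts := G.verts ∩ S
  finite_verts := G.finite_verts.subset inter_subset_left
  Adj u v := G.Adj u v ∧ u ∈ S ∧ v ∈ S
  adj_symm _ _ h := ⟨G.adj_symm _ _ h.1, h.2.2, h.2.1⟩
  adj_irrefl v h := G.adj_irrefl v h.1
  adj_mem _ _ h := ⟨G.adj_mem _ _ h.1, h.2.1⟩
  arc := G.arc
  arc_symm := G.arc_symm
  arc_path _ _ h := G.arc_path _ _ h.1
  arc_verts _ _ h := fun _ hx => G.arc_verts _ _ h.1 ⟨hx.1.1, hx.2⟩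
  arc_inter _ _ _ _ h h' hne := G.arc_inter _ _ _ _ h.1 h'.1 hne

/-- Deleting a set of vertices (together with all incident edges),
keeping the inherited embedding. -/
def delete (G : PlaneGraph) (X : Set (ℝ × ℝ)) : PlaneGraph := G.induce Xᶜ

/-- Deleting a single vertex. -/
def erase (G : PlaneGraph) (x : ℝ × ℝ) : PlaneGraph := G.delete {x}

/-- The point set of the plane drawing of `G`. -/
def drawing (G : PlaneGraph) : Set (ℝ × ℝ) :=
  G.verts ∪ ⋃ (u) (v) (_ : G.Adj u v), G.arc u v

/-- The faces of `G`: connected components of the complement of the drawing. -/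
def IsFace (G : PlaneGraph) (F : Set (ℝ × ℝ)) : Prop :=
  ∃ x, x ∉ G.drawing ∧ F = connectedComponentIn G.drawingᶜ x

/-- A vertex is external if it is incident to (i.e. lies on the boundary of)
an unbounded face. -/
def ExternalVertex (G : PlaneGraph) (v : ℝ × ℝ) : Prop :=
  v ∈ G.verts ∧ ∃ F, G.IsFace F ∧ ¬ Bornology.IsBounded F ∧ v ∈ closure F

/-- A triangle (cycle on three vertices) of `G`. -/
def IsTriangle (G : PlaneGraph) (a b c : ℝ × ℝ) : Prop :=
  a ≠ b ∧ a ≠ c ∧ b ≠ c ∧ G.Adj a b ∧ G.Adj b c ∧ G.Adj a c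

/-- `v` is contained in a triangle of `G`. -/
def InTriangle (G : PlaneGraph) (v : ℝ × ℝ) : Prop := ∃ b c, G.IsTriangle v b c

/-- The drawing of the closed curve formed by a triangle on `a`, `b`, `c`. -/
def triDrawing (G : PlaneGraph) (a b c : ℝ × ℝ) : Set (ℝ × ℝ) :=
  G.arc a b ∪ G.arc b c ∪ G.arc a c

/-- A face is triangular if its boundary is the drawing of a triangle of `G`. -/
def IsTriangularFace (G : PlaneGraph) (F : Set (ℝ × ℝ)) : Prop :=
  ∃ a b c, G.IsTriangle a b c ∧ frontier F = G.triDrawing a b c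

/-- The interior region of the closed curve drawn by a triangle: the union of the
bounded connected components of the complement of its drawing. -/
def triangleInterior (G : PlaneGraph) (a b c : ℝ × ℝ) : Set (ℝ × ℝ) :=
  {x | x ∉ G.triDrawing a b c ∧
    Bornology.IsBounded (connectedComponentIn (G.triDrawing a b c)ᶜ x)}

/-- A facial triangle: a triangle whose interior region is a face of `G`. -/
def IsFacialTriangle (G : PlaneGraph) (a b c : ℝ × ℝ) : Prop :=
  G.IsTriangle a b c ∧ G.IsFace (G.triangleInterior a b c)

/-- A weak near-triangulation: every bounded face is triangular and every vertex
is contained in a triangle. -/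
def IsWNT (G : PlaneGraph) : Prop :=
  (∀ F, G.IsFace F → Bornology.IsBounded F → G.IsTriangularFace F) ∧
  ∀ v ∈ G.verts, G.InTriangle v

/-- Reachability by walks in `G`. -/
def Reachable (G : PlaneGraph) (u v : ℝ × ℝ) : Prop := Relation.ReflTransGen G.Adj u v

/-- Connectedness of `G`. -/
def Connected (G : PlaneGraph) : Prop :=
  G.verts.Nonempty ∧ ∀ u ∈ G.verts, ∀ v ∈ G.verts, G.Reachable u v

/-- A cutvertex: a vertex whose deletion separates two other vertices. -/
def IsCutvertex (G : PlaneGraph) (v : ℝ × ℝ) : Prop :=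
  v ∈ G.verts ∧ ∃ a b, a ∈ G.verts ∧ b ∈ G.verts ∧ a ≠ v ∧ b ≠ v ∧
    G.Reachable a b ∧ ¬ (G.erase v).Reachable a b

/-- 2-connectivity: connected, on at least three vertices, with no cutvertex. -/
def TwoConnected (G : PlaneGraph) : Prop :=
  G.Connected ∧ 3 ≤ G.verts.ncard ∧ ∀ v, ¬ G.IsCutvertex v

/-- A near-triangulation: a 2-connected plane graph all of whose bounded faces
are triangular. -/
def IsNearTriangulation (G : PlaneGraph) : Prop :=
  G.TwoConnected ∧ ∀ F, G.IsFace F → Bornology.IsBounded F → G.IsTriangularFace F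

/-- A plane triangulation: a connected plane graph all of whose faces (including
the unbounded one) are triangular. -/
def IsTriangulation (G : PlaneGraph) : Prop :=
  G.Connected ∧ ∀ F, G.IsFace F → G.IsTriangularFace F

/-- A block of `G`, given by its vertex set `B`: a maximal set of vertices inducing
a connected subgraph without a cutvertex. -/
def IsBlock (G : PlaneGraph) (B : Set (ℝ × ℝ)) : Prop :=
  B ⊆ G.verts ∧ (G.induce B).Connected ∧ (∀ v, ¬ (G.induce B).IsCutvertex v) ∧
  ∀ B', B ⊆ B' → B' ⊆ G.verts → (G.induce B').Connected →
    (∀ v, ¬ (G.induce B').IsCutvertex v) → B' = B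

/-- A plane graph is outerplanar if all of its vertices are incident to the
unbounded face. -/
def IsOuterplanar (G : PlaneGraph) : Prop := ∀ v ∈ G.verts, G.ExternalVertex v

/-- A dominating set of `G`. -/
def IsDominatingSet (G : PlaneGraph) (D : Set (ℝ × ℝ)) : Prop :=
  D ⊆ G.verts ∧ ∀ v ∈ G.verts, v ∉ D → ∃ d ∈ D, G.Adj v d

/-- The domination number of `G`. -/
noncomputable def dominationNumber (G : PlaneGraph) : ℕ :=
  sInf {n | ∃ D, G.IsDominatingSet D ∧ D.ncard = n}

/-- `u` is problematic in `G` if `G − u` is not a weak near-triangulation. -/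
def Problematic (G : PlaneGraph) (u : ℝ × ℝ) : Prop := ¬ (G.erase u).IsWNT

/-- `x` is a `u`-bad vertex in `G`: a vertex of `G − u` not contained in a triangle
of `G − u`. -/
def IsBadFor (G : PlaneGraph) (u x : ℝ × ℝ) : Prop :=
  x ∈ G.verts ∧ x ≠ u ∧ ¬ (G.erase u).InTriangle x

end PlaneGraph

/-- Every nonvanishing continuous function on `X` has a continuous logarithm on `X`. -/
def HasContinuousLogs {α : Type*} [TopologicalSpace α] (X : Set α) : Prop :=
  ∀ f : α → ℂ, ContinuousOn f X → (∀ x ∈ X, f x ≠ 0) →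
    ∃ g : α → ℂ, ContinuousOn g X ∧ ∀ x ∈ X, Complex.exp (g x) = f x

namespace HasContinuousLogs

theorem of_subsingleton {α : Type*} [TopologicalSpace α] {X : Set α} (hX : X.Subsingleton) :
    HasContinuousLogs X := fun f _ hf =>
  ⟨fun x => Complex.log (f x), hX.continuousOn _, fun x hx => Complex.exp_log (hf x hx)⟩

theorem union {α : Type*} [TopologicalSpace α] {A B : Set α} (hA : HasContinuousLogs A)
    (hB : HasContinuousLogs B) (hAc : IsClosed A) (hBc : IsClosed B)
    (hAB : (A ∩ B).Subsingleton) : HasContinuousLogs (A ∪ B) := by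
  classical
  intro f hf hf0
  obtain ⟨a, ha, hae⟩ := hA f (hf.mono subset_union_left) fun x hx => hf0 x (Or.inl hx)
  obtain ⟨b, hb, hbe⟩ := hB f (hf.mono subset_union_right) fun x hx => hf0 x (Or.inr hx)
  obtain ⟨k, hk, hkx⟩ : ∃ k : ℂ, Complex.exp k = 1 ∧ ∀ x ∈ A ∩ B, b x + k = a x := by
    rcases (A ∩ B).eq_empty_or_nonempty with h | ⟨c, hc⟩
    · exact ⟨0, by simp, by simp [h]⟩
    · refine ⟨a c - b c, ?_, fun x hx => ?_⟩
      · rw [Complex.exp_sub, hae c hc.1, hbe c hc.2, div_self (hf0 c (Or.inl hc.1))]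
      · rw [hAB hx hc]; ring
  have hB' : ∀ x ∈ B, (if x ∈ A then a x else b x + k) = b x + k := by
    intro x hx
    split_ifs with h
    · exact (hkx x ⟨h, hx⟩).symm
    · rfl
  refine ⟨fun x => if x ∈ A then a x else b x + k, ?_, ?_⟩
  · refine ContinuousOn.union_of_isClosed (ha.congr fun x hx => if_pos hx) ?_ hAc hBc
    exact (hb.add continuousOn_const).congr hB'
  · rintro x (hx | hx)
    · simp only [if_pos hx, hae x hx]
    · simp only [hB' x hx, Complex.exp_add, hk, mul_one, hbe x hx]

end HasContinuousLogs

theorem exists_continuous_log {α : Type*} [TopologicalSpace α] [SimplyConnectedSpace α]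
    [LocallyPathConnectedSpace α] {f : α → ℂ} (hf : Continuous f) (h0 : ∀ x, f x ≠ 0) :
    ∃ g : α → ℂ, Continuous g ∧ ∀ x, Complex.exp (g x) = f x := by
  obtain ⟨a⟩ : Nonempty α := inferInstance
  obtain ⟨F, ⟨-, hF⟩, -⟩ := Complex.isCoveringMapOn_exp.existsUnique_continuousMap_lifts
    ⟨f, hf⟩ (a₀ := a) (Complex.exp_log (h0 a)) h0
  exact ⟨F, F.continuous, fun x => congrFun hF x⟩

theorem hasContinuousLogs_image_Icc {α : Type*} [TopologicalSpace α] [T4Space α]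
    {γ : unitInterval → α} (hγ : Continuous γ) (hinj : Function.Injective γ)
    (a b : unitInterval) : HasContinuousLogs (γ '' Icc a b) := by
  intro f hf hf0
  by_cases hab : a ≤ b
  swap
  · exact ⟨0, by simp [Icc_eq_empty hab], by simp [Icc_eq_empty hab]⟩
  have hmem : ∀ t : ℝ,
      γ (projIcc a b hab (projIcc 0 1 zero_le_one t)) ∈ γ '' Icc a b :=
    fun t => mem_image_of_mem γ (projIcc a b hab _).2
  obtain ⟨g, hg, hge⟩ := exists_continuous_log
    (f := fun t : ℝ => f (γ (projIcc a b hab (projIcc 0 1 zero_le_one t))))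
    (hf.comp_continuous (hγ.comp (continuous_subtype_val.comp
      (continuous_projIcc.comp continuous_projIcc))) hmem) fun t => hf0 _ (hmem t)
  obtain ⟨G, hG⟩ := ContinuousMap.exists_extension (hγ.isClosedEmbedding hinj)
    ⟨fun t : unitInterval => g t, hg.comp continuous_subtype_val⟩
  refine ⟨G, G.continuous.continuousOn, ?_⟩
  rintro _ ⟨t, ht, rfl⟩
  have h1 : G (γ t) = g t := DFunLike.congr_fun hG t
  rw [h1, hge, projIcc_val, projIcc_of_mem hab ht]

theorem not_hasContinuousLogs_of_frontier_subset {V Z : Set (ℝ × ℝ)}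
    (hb : Bornology.IsBounded V) {p : ℝ × ℝ} (hp : p ∈ V) (hpZ : p ∉ Z) (hZ : IsClosed Z)
    (hVZ : frontier V ⊆ Z) : ¬ HasContinuousLogs Z := by
  classical
  intro hlog
  let f : ℝ × ℝ → ℂ := fun z => ((z.1 - p.1 : ℝ) : ℂ) + ((z.2 - p.2 : ℝ) : ℂ) * Complex.I
  have hf : Continuous f := by fun_prop
  have hf0 : ∀ z, z ≠ p → f z ≠ 0 := by
    intro z hz h
    apply hz
    have h1 := congrArg Complex.re h
    have h2 := congrArg Complex.im h
    simp [f] at h1 h2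
    exact Prod.ext (by linarith) (by linarith)
  obtain ⟨g, hg, hge⟩ := hlog f hf.continuousOn fun z hz => hf0 z fun h => hpZ (h ▸ hz)
  obtain ⟨G, hG⟩ := ContinuousMap.exists_restrict_eq hZ
    ⟨Z.domRestrict g, continuousOn_iff_continuous_domRestrict.mp hg⟩
  have hGg : ∀ z ∈ Z, G z = g z := fun z hz => DFunLike.congr_fun hG ⟨z, hz⟩
  have hΦ : Continuous fun z => if z ∈ V then Complex.exp (G z) else f z := by
    refine Continuous.if (fun z hz => ?_) (by fun_prop) hf
    rw [hGg z (hVZ hz), hge z (hVZ hz)]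
  obtain ⟨L, hL, hLe⟩ := exists_continuous_log hΦ fun z => by
    split_ifs with h
    · exact Complex.exp_ne_zero _
    · exact hf0 z fun h' => h (h' ▸ hp)
  obtain ⟨R, hR0, hR⟩ := hb.subset_ball_lt 0 p
  let c : ℝ → ℝ × ℝ := fun θ => (p.1 + 2 * R * Real.cos θ, p.2 + 2 * R * Real.sin θ)
  have hc : Continuous c := by fun_prop
  have hcV : ∀ θ, c θ ∉ V := by
    intro θ hθ
    have h1 := hR hθ
    rw [Metric.mem_ball, Prod.dist_eq, max_lt_iff, Real.dist_eq, Real.dist_eq] at h1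
    simp only [c, add_sub_cancel_left] at h1
    have h2 := sq_lt_sq' (abs_lt.mp h1.1).1 (abs_lt.mp h1.1).2
    have h3 := sq_lt_sq' (abs_lt.mp h1.2).1 (abs_lt.mp h1.2).2
    nlinarith [Real.sin_sq_add_cos_sq θ]
  have hexp : ∀ θ : ℝ, Complex.exp (L (c θ) - θ * Complex.I) = 2 * R := by
    intro θ
    rw [Complex.exp_sub, hLe, if_neg (hcV θ), div_eq_iff (Complex.exp_ne_zero _),
      Complex.exp_mul_I]
    simp [f, c]
    ring
  have hconst := Complex.isCoveringMap_exp.const_of_comp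
    (g := fun θ : ℝ => L (c θ) - θ * Complex.I) (by fun_prop)
    (fun a a' => Subtype.ext ((hexp a).trans (hexp a').symm)) 0 (2 * Real.pi)
  have hcc : c (2 * Real.pi) = c 0 := by simp [c]
  simp only [hcc, Complex.ofReal_zero, zero_mul, sub_zero] at hconst
  have hpi : ((2 * Real.pi : ℝ) : ℂ) * Complex.I = 0 := by linear_combination hconst
  simp [Real.pi_ne_zero] at hpi

theorem isPreconnected_compl_closedBall (R : ℝ) (hR : 0 ≤ R) :
    IsPreconnected (Metric.closedBall (0 : ℝ × ℝ) R)ᶜ := by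
  have hrank : 1 < Module.rank ℝ (ℝ × ℝ) := by
    rw [rank_prod', Module.rank_self, one_add_one_eq_two]; exact Cardinal.one_lt_two
  have h := (isConnected_compl_singleton_of_one_lt_rank hrank 0).isPreconnected
  have hc : ContinuousOn (fun z : ℝ × ℝ => (1 + R / ‖z‖) • z) {0}ᶜ := by
    refine ContinuousOn.smul (continuousOn_const.add (continuousOn_const.div
      continuous_norm.continuousOn fun z hz => norm_ne_zero_iff.mpr hz)) continuousOn_id
  convert h.image _ hc
  ext z
  simp only [mem_compl_iff, Metric.mem_closedBall, dist_zero_right, not_le, mem_image,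
    mem_singleton_iff]
  constructor
  · intro hz
    have hz0 : 0 < ‖z‖ := hR.trans_lt hz
    have hpos : 0 < 1 - R / ‖z‖ := by
      rw [sub_pos, div_lt_one hz0]; exact hz
    refine ⟨(1 - R / ‖z‖) • z, smul_ne_zero hpos.ne' (norm_pos_iff.mp hz0), ?_⟩
    rw [norm_smul, Real.norm_of_nonneg hpos.le, smul_smul]
    have : (1 + R / ((1 - R / ‖z‖) * ‖z‖)) * (1 - R / ‖z‖) = 1 := by
      have h3 : ‖z‖ - R ≠ 0 := by linarith
      have h4 : (1 - R / ‖z‖) * ‖z‖ = ‖z‖ - R := by field_simp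
      rw [h4]; field_simp; ring
    rw [this, one_smul]
  · rintro ⟨w, hw, rfl⟩
    have hw0 : 0 < ‖w‖ := norm_pos_iff.mpr hw
    rw [norm_smul, Real.norm_of_nonneg (by positivity), add_mul, div_mul_cancel₀ _ hw0.ne']
    linarith

theorem compl_subset_of_frontier_subset {F Z : Set (ℝ × ℝ)} {R : ℝ}
    (hR : (Metric.closedBall (0 : ℝ × ℝ) R)ᶜ ⊆ F) (hZ : IsClosed Z) (hFZ : frontier F ⊆ Z)
    (hlog : HasContinuousLogs Z) : Zᶜ ⊆ F := by
  intro p hp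
  by_contra hpF
  refine not_hasContinuousLogs_of_frontier_subset (V := Fᶜ) ?_ hpF hp hZ ?_ hlog
  · exact Metric.isBounded_closedBall.subset (compl_subset_comm.mp hR)
  · rwa [frontier_compl]

namespace PlaneGraph

/-- The set of arcs drawing the edges of `G`. -/
def arcs (G : PlaneGraph) : Set (Set (ℝ × ℝ)) := {A | ∃ u v, G.Adj u v ∧ A = G.arc u v}

variable (G : PlaneGraph)

theorem finite_arcs : G.arcs.Finite := by
  refine (G.finite_verts.image2 G.arc G.finite_verts).subset ?_
  rintro _ ⟨u, v, h, rfl⟩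
  exact mem_image2_of_mem (G.adj_mem _ _ h) (G.adj_mem _ _ (G.adj_symm _ _ h))

theorem drawing_eq : G.drawing = G.verts ∪ ⋃ A ∈ G.arcs, A := by
  ext x
  simp only [drawing, arcs, mem_union, mem_iUnion, mem_ofPred_eq]
  grind

theorem isCompact_of_mem_arcs {A : Set (ℝ × ℝ)} (hA : A ∈ G.arcs) : IsCompact A := by
  obtain ⟨u, v, h, rfl⟩ := hA
  obtain ⟨γ, -, hγ⟩ := G.arc_path u v h
  rw [hγ]
  exact isCompact_range γ.continuous

theorem isCompact_drawing : IsCompact G.drawing := by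
  rw [drawing_eq]
  exact G.finite_verts.isCompact.union
    (G.finite_arcs.isCompact_biUnion fun A hA => G.isCompact_of_mem_arcs hA)

theorem arc_subset_drawing {u v : ℝ × ℝ} (h : G.Adj u v) : G.arc u v ⊆ G.drawing := by
  rw [drawing_eq]
  exact fun x hx => Or.inr (mem_iUnion₂.mpr ⟨_, ⟨u, v, h, rfl⟩, hx⟩)

theorem verts_subset_drawing : G.verts ⊆ G.drawing := subset_union_left

variable {G}

theorem IsFace.isOpen {F : Set (ℝ × ℝ)} (hF : G.IsFace F) : IsOpen F := by
  obtain ⟨x, -, rfl⟩ := hF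
  exact G.isCompact_drawing.isClosed.isOpen_compl.connectedComponentIn

theorem IsFace.isPreconnected {F : Set (ℝ × ℝ)} (hF : G.IsFace F) : IsPreconnected F := by
  obtain ⟨x, -, rfl⟩ := hF
  exact isPreconnected_connectedComponentIn

theorem IsFace.subset_compl {F : Set (ℝ × ℝ)} (hF : G.IsFace F) : F ⊆ G.drawingᶜ := by
  obtain ⟨x, -, rfl⟩ := hF
  exact connectedComponentIn_subset _ _

theorem IsFace.eq_connectedComponentIn {F : Set (ℝ × ℝ)} (hF : G.IsFace F) {x : ℝ × ℝ}
    (hx : x ∈ F) : F = connectedComponentIn G.drawingᶜ x := by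
  obtain ⟨y, -, rfl⟩ := hF
  exact connectedComponentIn_eq hx

theorem IsFace.frontier_subset {F : Set (ℝ × ℝ)} (hF : G.IsFace F) :
    frontier F ⊆ G.drawing := by
  intro y hy
  by_contra hyd
  have hC : G.IsFace (connectedComponentIn G.drawingᶜ y) := ⟨y, hyd, rfl⟩
  have hyC : y ∈ connectedComponentIn G.drawingᶜ y := mem_connectedComponentIn hyd
  obtain ⟨z, hzC, hzF⟩ := mem_closure_iff.mp hy.1 _ hC.isOpen hyC
  rw [hC.eq_connectedComponentIn hzC, ← hF.eq_connectedComponentIn hzF] at hyC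
  exact hy.2 (hF.isOpen.interior_eq.symm ▸ hyC)

variable (G)

theorem exists_face_compl_closedBall_subset :
    ∃ F R, G.IsFace F ∧ (Metric.closedBall (0 : ℝ × ℝ) R)ᶜ ⊆ F := by
  obtain ⟨R, hR0, hR⟩ := G.isCompact_drawing.isBounded.subset_closedBall_lt 0 0
  have hx : ((R + 1, 0) : ℝ × ℝ) ∈ (Metric.closedBall (0 : ℝ × ℝ) R)ᶜ := by
    simp [Prod.norm_def, abs_of_pos (show 0 < R + 1 by linarith)]
  have hsub := compl_subset_compl.mpr hR
  exact ⟨_, R, ⟨_, hsub hx, rfl⟩,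
    (isPreconnected_compl_closedBall R hR0.le).subset_connectedComponentIn hx hsub⟩

/-- The part of an arc spanned by its intersection with a closed set `Y` contains an endpoint
of the arc only if `Y` does. -/
theorem exists_subset_arc_hasContinuousLogs {Y A : Set (ℝ × ℝ)} (hY : IsClosed Y)
    (hA : A ∈ G.arcs) : ∃ P ⊆ A, IsClosed P ∧ HasContinuousLogs P ∧ Y ∩ A ⊆ P ∧
      P ∩ G.verts ⊆ Y := by
  obtain ⟨u, v, h, rfl⟩ := hA
  obtain ⟨γ, hinj, hγ⟩ := G.arc_path u v h
  have hK : IsCompact (γ ⁻¹' Y) := (hY.preimage γ.continuous).isCompact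
  rcases (γ ⁻¹' Y).eq_empty_or_nonempty with hE | hE
  · refine ⟨∅, empty_subset _, isClosed_empty, .of_subsingleton subsingleton_empty, ?_,
      by simp⟩
    rintro x ⟨hxY, hxA⟩
    rw [hγ] at hxA
    obtain ⟨t, rfl⟩ := hxA
    exact (hE ▸ hxY : t ∈ (∅ : Set _)).elim
  · obtain ⟨a, haK, ha⟩ := hK.exists_isLeast hE
    obtain ⟨b, hbK, hb⟩ := hK.exists_isGreatest hE
    refine ⟨γ '' Icc a b, hγ ▸ image_subset_range _ _,
      (isCompact_Icc.image γ.continuous).isClosed,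
      hasContinuousLogs_image_Icc γ.continuous hinj a b, ?_, ?_⟩
    · rintro x ⟨hxY, hxA⟩
      rw [hγ] at hxA
      obtain ⟨t, rfl⟩ := hxA
      exact mem_image_of_mem γ ⟨ha hxY, hb hxY⟩
    · rintro _ ⟨⟨t, ht, rfl⟩, hx⟩
      rcases G.arc_verts u v h ⟨hx, hγ ▸ mem_range_self t⟩ with hu | hv
      · have : t = a := by
          have h0 : t = 0 := hinj (by rw [hu, γ.source])
          exact le_antisymm (h0 ▸ unitInterval.nonneg') ht.1
        exact this ▸ haK
      · have : t = b := by
          have h1 : t = 1 := hinj (by rw [hv, γ.target])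
          exact le_antisymm ht.2 (h1 ▸ unitInterval.le_one')
        exact this ▸ hbK

theorem inter_subset_verts {A B : Set (ℝ × ℝ)} (hA : A ∈ G.arcs) (hB : B ∈ G.arcs)
    (hAB : A ≠ B) : A ∩ B ⊆ G.verts := by
  obtain ⟨u, v, h, rfl⟩ := hA
  obtain ⟨u', v', h', rfl⟩ := hB
  intro x hx
  have hne : ({u, v} : Set (ℝ × ℝ)) ≠ {u', v'} := by
    intro heq
    rcases (pair_eq_pair_iff.mp heq) with ⟨rfl, rfl⟩ | ⟨rfl, rfl⟩
    · exact hAB rfl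
    · exact hAB (G.arc_symm _ _)
  rcases (G.arc_inter u v u' v' h h' hne hx).1 with rfl | rfl
  · exact G.adj_mem _ _ h
  · exact G.adj_mem _ _ (G.adj_symm _ _ h)

theorem eq_arc_of_mem {A : Set (ℝ × ℝ)} (hA : A ∈ G.arcs) {s t : ℝ × ℝ} (hst : s ≠ t)
    (hs : s ∈ A ∩ G.verts) (ht : t ∈ A ∩ G.verts) : A = G.arc s t := by
  obtain ⟨u, v, h, rfl⟩ := hA
  rcases G.arc_verts u v h hs.symm with rfl | rfl <;>
    rcases G.arc_verts _ _ h ht.symm with rfl | rfl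
  · exact (hst rfl).elim
  · rfl
  · exact G.arc_symm _ _
  · exact (hst rfl).elim

theorem exists_vertex_mem_closure_of_compl_closedBall_subset {F : Set (ℝ × ℝ)} {R : ℝ}
    (hF : G.IsFace F) (hR : (Metric.closedBall (0 : ℝ × ℝ) R)ᶜ ⊆ F) {s t r : ℝ × ℝ}
    (hr : r ∈ G.verts) (hrs : r ≠ s) (hrt : r ≠ t) :
    ∃ x ∈ G.verts, x ∈ closure F ∧ x ≠ s ∧ x ≠ t := by
  by_contra! hcon
  set Y := frontier F with hYdef
  have hY : IsClosed Y := isClosed_frontier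
  have hYst : ∀ x ∈ G.verts, x ∈ Y → x = s ∨ x = t := fun x hx hxY =>
    or_iff_not_imp_left.mpr (hcon x hx hxY.1)
  have hPex : ∀ A, ∃ P ⊆ A, IsClosed P ∧ HasContinuousLogs P ∧ (A ∈ G.arcs → Y ∩ A ⊆ P) ∧
      P ∩ G.verts ⊆ Y ∧ (P.Nonempty → A ∈ G.arcs) := by
    intro A
    by_cases hA : A ∈ G.arcs
    · obtain ⟨P, h1, h2, h3, h4, h5⟩ := G.exists_subset_arc_hasContinuousLogs hY hA
      exact ⟨P, h1, h2, h3, fun _ => h4, h5, fun _ => hA⟩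
    · exact ⟨∅, empty_subset _, isClosed_empty, .of_subsingleton subsingleton_empty,
        fun h => (hA h).elim, by simp, by simp⟩
  choose P hPA hPc hPl hPY hPv hPn using hPex
  set W := G.verts ∩ Y with hWdef
  have hWst : W ⊆ {s, t} := fun x hx => hYst x hx.1 hx.2
  have hWf : W.Finite := G.finite_verts.subset inter_subset_left
  have hPinter : ∀ A B, A ≠ B → P A ∩ P B ⊆ W := by
    intro A B hAB x hx
    have hxv : x ∈ G.verts := G.inter_subset_verts (hPn A ⟨x, hx.1⟩) (hPn B ⟨x, hx.2⟩) hAB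
      ⟨hPA A hx.1, hPA B hx.2⟩
    exact ⟨hxv, hPv A ⟨hx.1, hxv⟩⟩
  have hbase : HasContinuousLogs (P (G.arc s t) ∪ W) := by
    have hW : W = (W ∩ {s}) ∪ (W ∩ {t}) := by
      rw [← inter_union_distrib_left, ← insert_eq, inter_eq_left.mpr hWst]
    have hsub : ∀ a : ℝ × ℝ, (W ∩ {a}).Subsingleton := fun a =>
      subsingleton_singleton.anti inter_subset_right
    have hcl : ∀ a : ℝ × ℝ, IsClosed (W ∩ {a}) := fun a =>
      (hWf.subset inter_subset_left).isClosed
    rw [hW, ← union_assoc]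
    exact ((hPl _).union (.of_subsingleton (hsub s)) (hPc _) (hcl s)
      ((hsub s).anti inter_subset_right)).union (.of_subsingleton (hsub t))
      ((hPc _).union (hcl s)) (hcl t) ((hsub t).anti inter_subset_right)
  have key : ∀ 𝓑 : Set (Set (ℝ × ℝ)), 𝓑.Finite → (G.arc s t) ∉ 𝓑 →
      IsClosed (P (G.arc s t) ∪ W ∪ ⋃ A ∈ 𝓑, P A) ∧
      HasContinuousLogs (P (G.arc s t) ∪ W ∪ ⋃ A ∈ 𝓑, P A) := by
    intro 𝓑 h𝓑
    induction 𝓑, h𝓑 using Set.Finite.induction_on with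
    | empty => exact fun _ => by simpa using ⟨(hPc _).union hWf.isClosed, hbase⟩
    | @insert A 𝓒 hA h𝓒 ih =>
      intro hst
      rw [mem_insert_iff, not_or] at hst
      obtain ⟨ihc, ihl⟩ := ih hst.2
      rw [biUnion_insert, union_comm (P A), ← union_assoc]
      refine ⟨ihc.union (hPc A), ihl.union (hPl A) ihc (hPc A) ?_⟩
      have hsub : (P (G.arc s t) ∪ W ∪ ⋃ B ∈ 𝓒, P B) ∩ P A ⊆ W := by
        rintro x ⟨(hx | hx) | hx, hxA⟩
        · exact hPinter _ _ hst.1 ⟨hx, hxA⟩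
        · exact hx
        · obtain ⟨B, hB, hxB⟩ := mem_iUnion₂.mp hx
          exact hPinter B A (fun h => hA (h ▸ hB)) ⟨hxB, hxA⟩
      intro x hx y hy
      by_contra hxy
      have hAa := hPn A ⟨x, hx.2⟩
      have hAxy := G.eq_arc_of_mem hAa hxy ⟨hPA A hx.2, (hsub hx).1⟩
        ⟨hPA A hy.2, (hsub hy).1⟩
      rcases hWst (hsub hx) with rfl | rfl <;> rcases hWst (hsub hy) with rfl | rfl
      · exact hxy rfl
      · exact hst.1 hAxy.symm
      · exact hst.1 (hAxy.trans (G.arc_symm _ _)).symm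
      · exact hxy rfl
  obtain ⟨hZc, hZl⟩ := key (G.arcs \ {G.arc s t}) (G.finite_arcs.subset sdiff_subset) (by simp)
  have hYZ : Y ⊆ P (G.arc s t) ∪ W ∪ ⋃ A ∈ G.arcs \ {G.arc s t}, P A := by
    intro x hx
    have hxd := hF.frontier_subset hx
    rw [drawing_eq] at hxd
    rcases hxd with hxv | hxa
    · exact Or.inl (Or.inr ⟨hxv, hx⟩)
    · obtain ⟨A, hA, hxA⟩ := mem_iUnion₂.mp hxa
      have hxP := hPY A hA ⟨hx, hxA⟩
      by_cases h : A = G.arc s t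
      · exact Or.inl (Or.inl (h ▸ hxP))
      · exact Or.inr (mem_iUnion₂.mpr ⟨A, ⟨hA, h⟩, hxP⟩)
  have hrY : r ∉ Y := fun h => (hYst r hr h).elim hrs hrt
  have hrF := compl_subset_of_frontier_subset hR hZc hYZ hZl (a := r) (by
    rintro ((h | h) | h)
    · exact hrY (hPv _ ⟨h, hr⟩)
    · exact hrY h.2
    · obtain ⟨A, -, hA⟩ := mem_iUnion₂.mp h
      exact hrY (hPv A ⟨hA, hr⟩))
  exact hF.subset_compl hrF (G.verts_subset_drawing hr)

end PlaneGraph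

namespace PlaneGraph

variable {G : PlaneGraph}

theorem not_isBounded_of_compl_closedBall_subset {F : Set (ℝ × ℝ)} {R : ℝ}
    (hR : (Metric.closedBall (0 : ℝ × ℝ) R)ᶜ ⊆ F) : ¬ Bornology.IsBounded F := by
  intro hb
  refine NormedSpace.unbounded_univ ℝ (ℝ × ℝ)
    ((hb.union (Metric.isBounded_closedBall (x := (0 : ℝ × ℝ)) (r := R))).subset ?_)
  rw [univ_subset_iff, union_comm, ← compl_subset_iff_union]
  exact hR

/-- If all bounded faces are triangular, an internal vertex has at least three neighbors. -/
theorem exists_adj_of_not_externalVertex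
    (hG : ∀ F, G.IsFace F → Bornology.IsBounded F → G.IsTriangularFace F) {v : ℝ × ℝ}
    (hv : v ∈ G.verts) (hvint : ¬ G.ExternalVertex v) {u w : ℝ × ℝ} (hu : v ≠ u) (hw : v ≠ w) :
    ∃ y, G.Adj v y ∧ y ≠ u ∧ y ≠ w := by
  by_contra! hcon
  have hN : ∀ y, G.Adj v y → y ∈ ({v, u, w} : Set (ℝ × ℝ)) := fun y hy => by
    by_cases h : y = u
    · simp [h]
    · simp [hcon y hy h]
  have hvS : v ∈ ({v, u, w} : Set (ℝ × ℝ)) := by simp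
  set H := G.induce {v, u, w}
  have hvH : v ∈ H.verts := ⟨hv, hvS⟩
  obtain ⟨U, R, hU, hUR⟩ := H.exists_face_compl_closedBall_subset
  obtain ⟨x, hxH, hxU, hxu, hxw⟩ :=
    H.exists_vertex_mem_closure_of_compl_closedBall_subset hU hUR hvH hu hw
  obtain rfl : x = v := by
    rcases hxH.2 with h | h | h
    · exact h
    · exact (hxu h).elim
    · exact (hxw h).elim
  obtain ⟨F₀, R₀, hF₀, hR₀⟩ := G.exists_face_compl_closedBall_subset
  have hxF₀ : x ∉ closure F₀ := fun h =>
    hvint ⟨hv, F₀, hF₀, not_isBounded_of_compl_closedBall_subset hR₀, h⟩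
  have hC : IsClosed (closure F₀ ∪ (G.verts \ {x} ∪ ⋃ A ∈ {A ∈ G.arcs | x ∉ A}, A)) := by
    refine isClosed_closure.union ((G.finite_verts.subset sdiff_subset).isClosed.union ?_)
    exact (G.finite_arcs.subset (sep_subset _ _)).isClosed_biUnion fun A hA =>
      (G.isCompact_of_mem_arcs hA.1).isClosed
  have hxC : x ∈ (closure F₀ ∪ (G.verts \ {x} ∪ ⋃ A ∈ {A ∈ G.arcs | x ∉ A}, A))ᶜ := by
    rintro (h | h | h)
    · exact hxF₀ h
    · exact h.2 rfl
    · obtain ⟨A, hA, hxA⟩ := mem_iUnion₂.mp h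
      exact hA.2 hxA
  obtain ⟨ε, hε, hD⟩ := Metric.isOpen_iff.mp hC.isOpen_compl x hxC
  have hDarc : ∀ a b, G.Adj a b → x ∉ G.arc a b → Disjoint (Metric.ball x ε) (G.arc a b) :=
    fun a b h hx => Set.disjoint_left.mpr fun z hz hza =>
      hD hz (Or.inr (Or.inr (mem_iUnion₂.mpr ⟨_, ⟨⟨a, b, h, rfl⟩, hx⟩, hza⟩)))
  obtain ⟨y, hyD, hyU⟩ := mem_closure_iff.mp hxU _ Metric.isOpen_ball (Metric.mem_ball_self hε)
  have hyH : y ∉ H.drawing := hU.subset_compl hyU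
  have hyG : y ∉ G.drawing := by
    rw [drawing_eq]
    rintro (h | h)
    · by_cases hyx : y = x
      · exact hyH (H.verts_subset_drawing (hyx ▸ hvH))
      · exact hD hyD (Or.inr (Or.inl ⟨h, hyx⟩))
    · obtain ⟨_, ⟨a, b, hab, rfl⟩, hya⟩ := mem_iUnion₂.mp h
      by_cases hxa : x ∈ G.arc a b
      · have habH : H.Adj a b := by
          rcases G.arc_verts a b hab ⟨hv, hxa⟩ with rfl | rfl
          · exact ⟨hab, hvS, hN _ hab⟩
          · exact ⟨hab, hN _ (G.adj_symm _ _ hab), hvS⟩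
        exact hyH (H.arc_subset_drawing habH hya)
      · exact Set.disjoint_left.mp (hDarc a b hab hxa) hyD hya
  obtain ⟨F, hF, hyF⟩ : ∃ F, G.IsFace F ∧ y ∈ F :=
    ⟨_, ⟨y, hyG, rfl⟩, mem_connectedComponentIn hyG⟩
  have hFb : Bornology.IsBounded F := by
    by_contra hFb
    obtain ⟨z, hzF, hz⟩ : ∃ z ∈ F, z ∉ Metric.closedBall (0 : ℝ × ℝ) R₀ := by
      by_contra! h
      exact hFb (Metric.isBounded_closedBall.subset h)
    have : F = F₀ := (hF.eq_connectedComponentIn hzF).trans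
      (hF₀.eq_connectedComponentIn (hR₀ hz)).symm
    exact hD hyD (Or.inl (subset_closure (this ▸ hyF)))
  obtain ⟨a, b, c, ⟨-, -, -, hab, hbc, hac⟩, hfr⟩ := hG F hF hFb
  have hxT : x ∈ G.triDrawing a b c := by
    by_contra hxT
    simp only [triDrawing, mem_union, not_or] at hxT
    have hdis : Disjoint (Metric.ball x ε) (frontier F) := by
      rw [hfr, triDrawing, disjoint_union_right, disjoint_union_right]
      exact ⟨⟨hDarc a b hab hxT.1.1, hDarc b c hbc hxT.1.2⟩, hDarc a c hac hxT.2⟩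
    have hsub := (convex_ball x ε).isPreconnected.subset_of_closure_inter_subset hF.isOpen
      ⟨y, hyD, hyF⟩ fun z hz => by
        by_contra hzF
        exact Set.disjoint_left.mp hdis hz.2 ⟨hz.1, fun h => hzF (interior_subset h)⟩
    exact hF.subset_compl (hsub (Metric.mem_ball_self hε)) (G.verts_subset_drawing hv)
  have hxabc : x = a ∨ x = b ∨ x = c := by
    rcases hxT with (h | h) | h
    · have := G.arc_verts a b hab ⟨hv, h⟩
      simp only [mem_insert_iff, mem_singleton_iff] at this; tauto
    · have := G.arc_verts b c hbc ⟨hv, h⟩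
      simp only [mem_insert_iff, mem_singleton_iff] at this; tauto
    · have := G.arc_verts a c hac ⟨hv, h⟩
      simp only [mem_insert_iff, mem_singleton_iff] at this; tauto
  have habc : a ∈ ({x, u, w} : Set (ℝ × ℝ)) ∧ b ∈ ({x, u, w} : Set (ℝ × ℝ)) ∧
      c ∈ ({x, u, w} : Set (ℝ × ℝ)) := by
    rcases hxabc with rfl | rfl | rfl
    · exact ⟨hvS, hN _ hab, hN _ hac⟩
    · exact ⟨hN _ (G.adj_symm _ _ hab), hvS, hN _ hbc⟩
    · exact ⟨hN _ (G.adj_symm _ _ hac), hN _ (G.adj_symm _ _ hbc), hvS⟩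
  have hfrH : frontier F ⊆ H.drawing := by
    rw [hfr]
    exact union_subset (union_subset
      (H.arc_subset_drawing (u := a) (v := b) ⟨hab, habc.1, habc.2.1⟩)
      (H.arc_subset_drawing (u := b) (v := c) ⟨hbc, habc.2.1, habc.2.2⟩))
      (H.arc_subset_drawing (u := a) (v := c) ⟨hac, habc.1, habc.2.2⟩)
  have hUF : U ⊆ F := hU.isPreconnected.subset_of_closure_inter_subset hF.isOpen
    ⟨y, hyU, hyF⟩ fun z hz => by
      by_contra hzF
      exact hU.subset_compl hz.2 (hfrH ⟨hz.1, fun h => hzF (interior_subset h)⟩)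
  exact not_isBounded_of_compl_closedBall_subset hUR (hFb.subset hUF)

theorem exists_externalVertex_ne (hV : 3 ≤ G.verts.ncard) (s t : ℝ × ℝ) :
    ∃ x, G.ExternalVertex x ∧ x ≠ s ∧ x ≠ t := by
  obtain ⟨r, hr, hrst⟩ : ∃ r ∈ G.verts, r ∉ ({s, t} : Set (ℝ × ℝ)) :=
    exists_mem_notMem_of_ncard_lt_ncard (by
      have := ncard_insert_le s {t}
      rw [ncard_singleton] at this
      omega)
  simp only [mem_insert_iff, mem_singleton_iff, not_or] at hrst
  obtain ⟨F, R, hF, hR⟩ := G.exists_face_compl_closedBall_subset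
  obtain ⟨x, hx, hxF, hxs, hxt⟩ :=
    G.exists_vertex_mem_closure_of_compl_closedBall_subset hF hR hr hrst.1 hrst.2
  exact ⟨x, ⟨hx, F, hF, not_isBounded_of_compl_closedBall_subset hR, hxF⟩, hxs, hxt⟩

end PlaneGraph

open Classical in
/-- Among three vertices of degree at least three in a graph on six vertices, if one of them is
adjacent to neither of the others, then all three have a common neighbor. -/
theorem exists_common_neighbor_of_isolated {α : Type*} {V : Finset α} {r : α → α → Prop}
    (hirr : ∀ a, ¬ r a a) (hV : V.card = 6) {x y z : α} (hx : x ∈ V) (hy : y ∈ V)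
    (hz : z ∈ V) (hxy : x ≠ y) (hxz : x ≠ z) (hyz : y ≠ z)
    (dx : 3 ≤ (V.filter (r x)).card) (dy : 3 ≤ (V.filter (r y)).card)
    (dz : 3 ≤ (V.filter (r z)).card) (hxz' : ¬ r x z) (hyz' : ¬ r y z) (hzx : ¬ r z x)
    (hzy : ¬ r z y) : ∃ c ∈ V, r x c ∧ r y c ∧ r z c := by
  have hE : (V \ {x, y, z}).card = 3 := by
    rw [Finset.card_sdiff_of_subset (by grind), hV, Finset.card_eq_three.mpr
      ⟨x, y, z, hxy, hxz, hyz, rfl⟩]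
  have hNz : V.filter (r z) = V \ {x, y, z} :=
    Finset.eq_of_subset_of_card_le (by grind) (by omega)
  have hNx : (V.filter (r x)).erase y ⊆ V \ {x, y, z} := by grind
  have hNy : (V.filter (r y)).erase x ⊆ V \ {x, y, z} := by grind
  have h1 := Finset.pred_card_le_card_erase (s := V.filter (r x)) (a := y)
  have h2 := Finset.pred_card_le_card_erase (s := V.filter (r y)) (a := x)
  have h3 := Finset.card_le_card (Finset.union_subset hNx hNy)
  have h4 := Finset.card_union_add_card_inter ((V.filter (r x)).erase y)
    ((V.filter (r y)).erase x)
  obtain ⟨c, hc⟩ := Finset.card_pos.mp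
    (show 0 < ((V.filter (r x)).erase y ∩ (V.filter (r y)).erase x).card by omega)
  have hcz : c ∈ V.filter (r z) := hNz ▸ hNx (Finset.mem_inter.mp hc).1
  grind

open Classical in
/-- In a graph on six vertices, any at most three vertices of degree at least three are contained
in a single closed neighborhood. -/
theorem exists_dominating_of_card_le_three {α : Type*} {V I : Finset α} {r : α → α → Prop}
    (hsymm : ∀ a b, r a b → r b a) (hirr : ∀ a, ¬ r a a) (hV : V.card = 6) (hIV : I ⊆ V)
    (hI : I.card ≤ 3) (hdeg : ∀ v ∈ I, 3 ≤ (V.filter (r v)).card) :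
    ∃ x ∈ V, ∀ v ∈ I, v = x ∨ r x v := by
  obtain h | h | h | h : I.card = 0 ∨ I.card = 1 ∨ I.card = 2 ∨ I.card = 3 := by omega
  · obtain ⟨x, hx⟩ := Finset.card_pos.mp (show 0 < V.card by omega)
    exact ⟨x, hx, by simp [Finset.card_eq_zero.mp h]⟩
  · obtain ⟨x, rfl⟩ := Finset.card_eq_one.mp h
    exact ⟨x, hIV (by simp), by simp⟩
  · obtain ⟨x, y, hxy, rfl⟩ := Finset.card_eq_two.mp h
    have hx : x ∈ V := hIV (by simp)
    have hy : y ∈ V := hIV (by simp)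
    by_cases hr : r x y
    · exact ⟨x, hx, by simp [hr]⟩
    have hr' : ¬ r y x := fun h => hr (hsymm _ _ h)
    have h1 := Finset.card_union_add_card_inter (V.filter (r x)) (V.filter (r y))
    have h2 : (V.filter (r x) ∪ V.filter (r y)).card ≤ (V \ {x, y}).card :=
      Finset.card_le_card (by grind)
    rw [Finset.card_sdiff_of_subset hIV, hV, h] at h2
    have dx := hdeg x (by simp)
    have dy := hdeg y (by simp)
    obtain ⟨c, hc⟩ := Finset.card_pos.mp
      (show 0 < (V.filter (r x) ∩ V.filter (r y)).card by omega)
    exact ⟨c, by grind, by grind⟩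
  · obtain ⟨x, y, z, hxy, hxz, hyz, rfl⟩ := Finset.card_eq_three.mp h
    have hx : x ∈ V := hIV (by simp)
    have hy : y ∈ V := hIV (by simp)
    have hz : z ∈ V := hIV (by simp)
    have dx := hdeg x (by simp)
    have dy := hdeg y (by simp)
    have dz := hdeg z (by simp)
    have comm : ∀ a b, r a b ↔ r b a := fun a b => ⟨hsymm a b, hsymm b a⟩
    by_cases hX : r x y ∧ r x z
    · exact ⟨x, hx, by simp [hX]⟩
    by_cases hY : r y x ∧ r y z
    · exact ⟨y, hy, by simp [hY]⟩
    by_cases hZ : r z x ∧ r z y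
    · exact ⟨z, hz, by simp [hZ]⟩
    obtain ⟨c, hc, hcx, hcy, hcz⟩ : ∃ c ∈ V, r x c ∧ r y c ∧ r z c := by
      have h3 : (¬ r x z ∧ ¬ r y z) ∨ (¬ r x y ∧ ¬ r z y) ∨ (¬ r y x ∧ ¬ r z x) := by
        grind
      rcases h3 with h3 | h3 | h3
      · exact exists_common_neighbor_of_isolated hirr hV hx hy hz hxy hxz hyz dx dy dz
          h3.1 h3.2 (by grind) (by grind)
      · obtain ⟨c, hc, h⟩ := exists_common_neighbor_of_isolated hirr hV hx hz hy hxz hxy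
          hyz.symm dx dz dy h3.1 h3.2 (by grind) (by grind)
        exact ⟨c, hc, h.1, h.2.2, h.2.1⟩
      · obtain ⟨c, hc, h⟩ := exists_common_neighbor_of_isolated hirr hV hy hz hx hyz hxy.symm
          hxz.symm dy dz dx h3.1 h3.2 (by grind) (by grind)
        exact ⟨c, hc, h.2.2, h.1, h.2.1⟩
    exact ⟨c, hc, by simp [hsymm _ _ hcx, hsymm _ _ hcy, hsymm _ _ hcz]⟩

open PlaneGraph in
/-- Every near-triangulation on exactly 6 vertices has a vertex `x` whose closed
neighborhood contains all internal vertices. -/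
theorem nearTriangulation_six_vertices (G : PlaneGraph) (hG : G.IsNearTriangulation)
    (h6 : G.verts.ncard = 6) :
    ∃ x ∈ G.verts, ∀ v ∈ G.verts, ¬ G.ExternalVertex v → v = x ∨ G.Adj x v := by
  classical
  set V := G.finite_verts.toFinset with hVdef
  have hmem : ∀ v, v ∈ V ↔ v ∈ G.verts := fun v => G.finite_verts.mem_toFinset
  have hV : V.card = 6 := by rw [← h6, ncard_eq_toFinset_card _ G.finite_verts]
  have hext := G.exists_externalVertex_ne (by omega)
  obtain ⟨e₁, he₁, -, -⟩ := hext 0 0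
  obtain ⟨e₂, he₂, h21, -⟩ := hext e₁ e₁
  obtain ⟨e₃, he₃, h31, h32⟩ := hext e₁ e₂
  have hI : (V.filter fun v => ¬ G.ExternalVertex v).card ≤ 3 := by
    have hsub : ({e₁, e₂, e₃} : Finset (ℝ × ℝ)) ⊆ V.filter fun v => G.ExternalVertex v := by
      have := he₁.1; have := he₂.1; have := he₃.1
      grind
    have h3 := Finset.card_le_card hsub
    rw [Finset.card_eq_three.mpr ⟨e₁, e₂, e₃, h21.symm, h31.symm, h32.symm, rfl⟩] at h3
    have := Finset.card_filter_add_card_filter_not (s := V) fun v => G.ExternalVertex v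
    omega
  have hdeg : ∀ v ∈ V.filter fun v => ¬ G.ExternalVertex v, 3 ≤ (V.filter (G.Adj v)).card := by
    intro v hv
    rw [Finset.mem_filter, hmem] at hv
    have hadj : ∀ u w, v ≠ u → v ≠ w → ∃ y, G.Adj v y ∧ y ≠ u ∧ y ≠ w := fun u w hu hw =>
      exists_adj_of_not_externalVertex hG.2 hv.1 hv.2 hu hw
    have hne : ∀ y, G.Adj v y → v ≠ y := fun y hy h => G.adj_irrefl v (h ▸ hy)
    have hve : v ≠ e₁ := fun h => hv.2 (h ▸ he₁)
    obtain ⟨a, ha, -, -⟩ := hadj e₁ e₁ hve hve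
    obtain ⟨b, hb, hba, -⟩ := hadj a a (hne a ha) (hne a ha)
    obtain ⟨c, hc, hca, hcb⟩ := hadj a b (hne a ha) (hne b hb)
    have hadjV : ∀ y, G.Adj v y → y ∈ V.filter (G.Adj v) := fun y hy =>
      Finset.mem_filter.mpr ⟨(hmem y).mpr (G.adj_mem _ _ (G.adj_symm _ _ hy)), hy⟩
    have hsub : ({a, b, c} : Finset (ℝ × ℝ)) ⊆ V.filter (G.Adj v) := by
      have := hadjV a ha; have := hadjV b hb; have := hadjV c hc
      grind
    have h3 := Finset.card_le_card hsub
    rwa [Finset.card_eq_three.mpr ⟨a, b, c, hba.symm, hca.symm, hcb.symm, rfl⟩] at h3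
  obtain ⟨x, hx, hxI⟩ := exists_dominating_of_card_le_three G.adj_symm G.adj_irrefl hV
    (Finset.filter_subset _ _) hI hdeg
  exact ⟨x, (hmem x).mp hx, fun v hv hvi =>
    hxI v (Finset.mem_filter.mpr ⟨(hmem v).mpr hv, hvi⟩)⟩
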